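/- Let G = ⟨A, g, n⟩ be a 2-group where A ≅ C4 × C2^k is abelian, generated by a_1,…,a_{k+1} with a_1 of order 4 and a_i of order 2 for i ∈ {2,…,k+1}; g^2 = 1; conjugation by g inverts every element of A; n^g = n^{-1}; n normalises A; and n^2 ∈ A. If k ≥ 6, then either G is generalised dihedral, or G admits an oriented regular representation. -/

import Mathlib

section Defs

variable {G : Type*} [Group G]

/-- A permutation of `G` is an automorphism of the Cayley digraph `Cay(G,S)`
(whose arcs are pairs `(x,y)` with `y * x⁻¹ ∈ S`). -/
def IsCayleyAut (S : Set G) (φ : Equiv.Perm G) : Prop :=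
  ∀ x y : G, y * x⁻¹ ∈ S ↔ φ y * (φ x)⁻¹ ∈ S

/-- `Cay(G,S)` is a digraphical regular representation of `G`: every automorphism of the
Cayley digraph is a right translation. -/
def IsCayleyDRR (S : Set G) : Prop :=
  ∀ φ : Equiv.Perm G, IsCayleyAut S φ → ∃ g : G, ∀ v : G, φ v = v * g

/-- `G` admits an oriented regular representation. -/
def HasORR (H : Type*) [Group H] : Prop :=
  ∃ S : Set H, S ∩ S⁻¹ = ∅ ∧ IsCayleyDRR S

/-- `G` is a generalised dihedral group: it is generated by an abelian subgroup `A`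
together with an involution `τ` inverting every element of `A`. -/
def IsGeneralizedDihedral (H : Type*) [Group H] : Prop :=
  ∃ A : Subgroup H, (∀ a ∈ A, ∀ b ∈ A, a * b = b * a) ∧
    ∃ τ : H, τ ∉ A ∧ τ * τ = 1 ∧ (∀ a ∈ A, τ * a * τ = a⁻¹) ∧
      ∀ g : H, g ∈ A ∨ ∃ a ∈ A, g = a * τ

/-- The Imrich connection set with respect to the generating tuple `z 0, …, z (k-1)`. -/
def imrichSet (k : ℕ) (z : ℕ → G) : Set G :=
  z '' Set.Iio k ∪ {g | ∃ i, i + 1 < k ∧ g = z i * z (i + 1)} ∪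
    {z 0 * z 1 * z (k - 3) * z (k - 2), z 0 * z 1 * z (k - 2) * z (k - 1)}

end Defs

section ORRProof

open Set

variable {G : Type*} [Group G]

/-- Elements whose left multiplication commutes with every automorphism of `Cay(G,S)`. -/
def autF (S : Set G) : Subgroup G where
  carrier := {f | ∀ φ : Equiv.Perm G, IsCayleyAut S φ → ∀ v, φ (f * v) = f * φ v}
  mul_mem' := by
    intro a b ha hb φ hφ v
    rw [mul_assoc, ha φ hφ, hb φ hφ, mul_assoc]
  one_mem' := by
    intro φ hφ v
    simp
  inv_mem' := by
    intro a ha φ hφ v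
    have := ha φ hφ (a⁻¹ * v)
    rw [mul_inv_cancel_left] at this
    rw [this, inv_mul_cancel_left]

lemma conj_aut {S : Set G} {φ : Equiv.Perm G} (h : IsCayleyAut S φ) (v : G) :
    IsCayleyAut S ((Equiv.mulRight v).trans (φ.trans (Equiv.mulRight (φ v)⁻¹))) := by
  intro x y
  have h1 := h (x * v) (y * v)
  have e1 : y * v * (x * v)⁻¹ = y * x⁻¹ := by group
  rw [e1] at h1
  rw [h1]
  have e2 : φ (y * v) * (φ (x * v))⁻¹ =
    (φ (y * v) * (φ v)⁻¹) * (φ (x * v) * (φ v)⁻¹)⁻¹ := by group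
  rw [e2]
  rfl

lemma mem_autF {S : Set G} {f : G}
    (h : ∀ φ : Equiv.Perm G, IsCayleyAut S φ → φ 1 = 1 → φ f = f) : f ∈ autF S := by
  intro φ hφ v
  have h1 := h _ (conj_aut hφ v) (by simp)
  simp only [Equiv.trans_apply, Equiv.coe_mulRight] at h1
  exact mul_inv_eq_iff_eq_mul.1 h1

lemma autF_fix {S : Set G} {f : G} (hf : f ∈ autF S) {φ : Equiv.Perm G}
    (hφ : IsCayleyAut S φ) (h1 : φ 1 = 1) : φ f = f := by
  have := hf φ hφ 1
  simpa [h1] using this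

lemma aut_mem {S : Set G} {φ : Equiv.Perm G} (hφ : IsCayleyAut S φ) (h1 : φ 1 = 1) (s : G) :
    s ∈ S ↔ φ s ∈ S := by
  have := hφ 1 s
  simpa [h1] using this

/-- Number of common out-neighbours. -/
noncomputable def comN (S : Set G) (s t : G) : ℕ :=
  Set.ncard {w | w * s⁻¹ ∈ S ∧ w * t⁻¹ ∈ S}

lemma comN_aut {S : Set G} {φ : Equiv.Perm G} (hφ : IsCayleyAut S φ) (s t : G) :
    comN S (φ s) (φ t) = comN S s t := by
  unfold comN
  have : {w | w * (φ s)⁻¹ ∈ S ∧ w * (φ t)⁻¹ ∈ S} = φ '' {w | w * s⁻¹ ∈ S ∧ w * t⁻¹ ∈ S} := by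
    ext w
    constructor
    · rintro ⟨h1, h2⟩
      refine ⟨φ.symm w, ⟨?_, ?_⟩, by simp⟩
      · rw [hφ]; simpa using h1
      · rw [hφ]; simpa using h2
    · rintro ⟨w, ⟨h1, h2⟩, rfl⟩
      exact ⟨(hφ _ _).1 h1, (hφ _ _).1 h2⟩
  rw [this, Set.ncard_image_of_injective _ φ.injective]

/-- Number of elements of `S` sharing at least `τ` out-neighbours with `s`. -/
noncomputable def nbC (S : Set G) (τ : ℕ) (s : G) : ℕ :=
  Set.ncard {t | t ∈ S ∧ t ≠ s ∧ τ ≤ comN S s t}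

lemma nbC_aut {S : Set G} {φ : Equiv.Perm G} (hφ : IsCayleyAut S φ) (h1 : φ 1 = 1)
    (τ : ℕ) (s : G) : nbC S τ (φ s) = nbC S τ s := by
  unfold nbC
  have : {t | t ∈ S ∧ t ≠ φ s ∧ τ ≤ comN S (φ s) t} =
      φ '' {t | t ∈ S ∧ t ≠ s ∧ τ ≤ comN S s t} := by
    ext w
    constructor
    · rintro ⟨h2, h3, h4⟩
      refine ⟨φ.symm w, ⟨?_, ?_, ?_⟩, by simp⟩
      · rw [aut_mem hφ h1]; simpa using h2
      · rintro rfl; simp at h3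
      · rw [← comN_aut hφ]; simpa using h4
    · rintro ⟨w, ⟨h2, h3, h4⟩, rfl⟩
      refine ⟨(aut_mem hφ h1 _).1 h2, fun h => h3 (φ.injective h), ?_⟩
      rw [comN_aut hφ]; exact h4
  rw [this, Set.ncard_image_of_injective _ φ.injective]

lemma sub_aut {S B : Set G} {τ m : ℕ} (hB : ∀ s, s ∈ B ↔ s ∈ S ∧ m ≤ nbC S τ s)
    {φ : Equiv.Perm G} (hφ : IsCayleyAut S φ) : IsCayleyAut B φ := by
  have key : ∀ ψ : Equiv.Perm G, IsCayleyAut S ψ → ψ 1 = 1 → ∀ s, s ∈ B ↔ ψ s ∈ B := by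
    intro ψ hψ h1 s
    rw [hB, hB, nbC_aut hψ h1, aut_mem hψ h1]
  intro x y
  have := key _ (conj_aut hφ x) (by simp) (y * x⁻¹)
  simpa using this

/-- The rigid base set, coded by bit masks. -/
def baseU : Finset ℕ :=
  {0, 1, 2, 3, 4, 8, 16, 19, 21, 27, 32, 34, 36, 38, 40, 42, 46, 48, 51, 56}

/-- Number of representations of `v` as a sum of two elements of the base. -/
def rhoU (v : ℕ) : ℕ := (baseU.filter (fun x => x ^^^ v ∈ baseU)).card

/-- Degree in the threshold graph of the base. -/
def degU (τ a : ℕ) : ℕ := (baseU.filter (fun b => b ≠ a ∧ τ ≤ rhoU (a ^^^ b))).card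

lemma baseU_deg : ∀ a ∈ baseU, 3 ≤ degU 10 a := by decide +kernel

lemma baseU_sep : ∀ a ∈ ({0, 1, 2, 4, 8, 16, 32} : Finset ℕ), ∀ b ∈ baseU,
    degU 8 b = degU 8 a → degU 6 b = degU 6 a → b = a := by decide +kernel

lemma baseU_lt : ∀ a ∈ baseU, a < 64 := by decide +kernel

lemma comN_q_le [Finite G] {A : Subgroup G} [A.Normal] {X S : Set G} (hX : ∀ x ∈ X, x ∈ A) {q r : G}
    (hS : ∀ x, x ∈ S ↔ x ∈ X ∨ x = q ∨ x = r) (hq : q ∉ A) (hr : r ∉ A)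
    (hqq : q * q ∈ A) (hrr : r * r ∈ A) (hqr : q * r⁻¹ ∉ A) {t : G} (ht : t ∈ S) (htq : t ≠ q) :
    comN S q t ≤ 3 := by
  have hf : ∀ x : G, (QuotientGroup.mk' A) x = 1 ↔ x ∈ A := fun x => by simp
  generalize QuotientGroup.mk' A = f at hf
  have hq' := mt (hf q).1 hq
  have hr' := mt (hf r).1 hr
  have hqq' := (hf _).2 hqq
  have hrr' := (hf _).2 hrr
  have hqr' := mt (hf _).1 hqr
  simp only [map_mul, map_inv] at hqq' hrr' hqr'
  have hri : (f r)⁻¹ = f r := inv_eq_of_mul_eq_one_left hrr'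
  rw [hri] at hqr'
  have hsub : {w | w * q⁻¹ ∈ S ∧ w * t⁻¹ ∈ S} ⊆ {q * q, r * q, q * t} := by
    rintro w ⟨h1, h2⟩
    rw [hS] at h1
    rcases h1 with h1 | h1 | h1
    · have hw : f w = f q := by
        have := (hf _).2 (hX _ h1)
        rw [map_mul, map_inv, mul_inv_eq_one] at this
        exact this
      have e2 : f (w * t⁻¹) = f q * (f t)⁻¹ := by rw [map_mul, map_inv, hw]
      rw [hS] at ht
      rcases ht with ht | ht | ht
      · rw [(hf _).2 (hX _ ht), inv_one, mul_one] at e2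
        rw [hS] at h2
        rcases h2 with h2 | h2 | h2
        · exact absurd (e2.symm.trans ((hf _).2 (hX _ h2))) hq'
        · right; right
          exact mul_inv_eq_iff_eq_mul.1 h2
        · rw [h2] at e2
          rw [← e2] at hqr'
          exact absurd hrr' hqr'
      · exact absurd ht htq
      · subst ht
        rw [hri] at e2
        rw [hS] at h2
        rcases h2 with h2 | h2 | h2
        · exact absurd (e2.symm.trans ((hf _).2 (hX _ h2))) hqr'
        · rw [h2] at e2
          exact absurd (left_eq_mul.1 e2) hr'
        · rw [h2] at e2
          exact absurd (right_eq_mul.1 e2) hq'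
    · left; exact mul_inv_eq_iff_eq_mul.1 h1
    · right; left; exact mul_inv_eq_iff_eq_mul.1 h1
  refine (Set.ncard_le_ncard hsub (Set.toFinite _)).trans ?_
  refine (Set.ncard_insert_le _ _).trans ?_
  have := Set.ncard_insert_le (r * q) {q * t}
  rw [Set.ncard_singleton] at this
  omega

/-- Bit vector of a natural number. -/
def vb (k m : ℕ) : Fin k → ZMod 2 := fun i => if m.testBit i.val then 1 else 0

/-- Standard basis vectors (zero if out of range). -/
def wv (k j : ℕ) : Fin k → ZMod 2 := fun i => if i.val = j then 1 else 0

/-- The triple attached to the `j`-th basis vector. -/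
def tailT (k j : ℕ) : Finset (Fin k → ZMod 2) :=
  {wv k j, wv k j + wv k 0, wv k j + wv k (j - 1)}

/-- The full set of translates. -/
def setT (k : ℕ) : Set (Fin k → ZMod 2) :=
  {v | (∃ m ∈ baseU, v = vb k m) ∨ ∃ j, 6 ≤ j ∧ j < k ∧ v ∈ tailT k j}

lemma vb_add (k m m' : ℕ) : vb k m + vb k m' = vb k (m ^^^ m') := by
  ext i
  simp only [vb, Pi.add_apply, Nat.testBit_xor]
  cases m.testBit i.val <;> cases m'.testBit i.val <;> decide

lemma vb_hi {k m : ℕ} (hm : m < 64) (i : Fin k) (hi : 6 ≤ i.val) : vb k m i = 0 := by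
  have h : m.testBit i.val = false := by
    apply Nat.testBit_lt_two_pow
    calc m < 2 ^ 6 := hm
      _ ≤ 2 ^ i.val := Nat.pow_le_pow_right (by norm_num) hi
  simp [vb, h]

lemma vb_inj {k m m' : ℕ} (hk : 6 ≤ k) (hm : m < 64) (hm' : m' < 64) (h : vb k m = vb k m') :
    m = m' := by
  apply Nat.eq_of_testBit_eq
  intro i
  by_cases hi : i < 6
  · have := congrFun h ⟨i, by omega⟩
    simp only [vb] at this
    revert this
    cases m.testBit i <;> cases m'.testBit i <;> simp
  · have e : 2 ^ 6 ≤ 2 ^ i := Nat.pow_le_pow_right (by norm_num) (by omega)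
    rw [Nat.testBit_lt_two_pow (lt_of_lt_of_le hm e), Nat.testBit_lt_two_pow (lt_of_lt_of_le hm' e)]

lemma tail_at {k j : ℕ} (hj : 6 ≤ j) {t : Fin k → ZMod 2} (ht : t ∈ tailT k j) (i : Fin k) :
    (i.val = j → t i = 1) ∧ (j < i.val → t i = 0) ∧ (0 < i.val → i.val + 1 < j → t i = 0) := by
  simp only [tailT, Finset.mem_insert, Finset.mem_singleton] at ht
  rcases ht with rfl | rfl | rfl <;>
  · simp only [wv, Pi.add_apply]
    refine ⟨fun h => ?_, fun h => ?_, fun h h' => ?_⟩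
    all_goals
      first
      | rw [if_pos h]
      | rw [if_neg (by omega)]
    all_goals
      try rw [if_neg (by omega)]
      try simp

lemma T_top {k : ℕ} {t : Fin k → ZMod 2} (ht : t ∈ setT k) (J : Fin k) (hJ : 6 ≤ J.val)
    (h1 : t J ≠ 0) (h2 : ∀ i : Fin k, J.val < i.val → t i = 0) : t ∈ tailT k J.val := by
  rcases ht with ⟨m, hm, rfl⟩ | ⟨j, hj, hjk, ht⟩
  · exact absurd (vb_hi (baseU_lt m hm) J hJ) h1
  · have : j = J.val := by
      rcases lt_trichotomy j J.val with h | h | h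
      · exact absurd ((tail_at hj ht J).2.1 h) h1
      · exact h
      · have a := (tail_at hj ht ⟨j, hjk⟩).1 rfl
        rw [h2 ⟨j, hjk⟩ h] at a
        exact absurd a (by decide)
    rwa [← this]

lemma T_cover {k : ℕ} {v x : Fin k → ZMod 2} (J : Fin k) (hJ : 6 ≤ J.val)
    (h1 : v J ≠ 0) (h2 : ∀ i : Fin k, J.val < i.val → v i = 0)
    (hx : x ∈ setT k) (hxv : x + v ∈ setT k) :
    x ∈ tailT k J.val ∨ x + v ∈ tailT k J.val ∨ x ∈ tailT k (J.val + 1) := by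
  have hx' := hx
  rcases hx with ⟨m, hm, rfl⟩ | ⟨j, hj, hjk, hx⟩
  · right; left
    apply T_top hxv J hJ
    · rw [Pi.add_apply, vb_hi (baseU_lt m hm) J hJ, zero_add]; exact h1
    · intro i hi
      rw [Pi.add_apply, vb_hi (baseU_lt m hm) i (by omega), zero_add]; exact h2 i hi
  · rcases lt_trichotomy j J.val with h | h | h
    · right; left
      apply T_top hxv J hJ
      · rw [Pi.add_apply, (tail_at hj hx J).2.1 h, zero_add]; exact h1
      · intro i hi
        rw [Pi.add_apply, (tail_at hj hx i).2.1 (by omega), zero_add]; exact h2 i hi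
    · left; rwa [← h]
    · right; right
      by_cases hh : j = J.val + 1
      · rwa [← hh]
      · exfalso
        have hy : x + v ∈ tailT k j := by
          apply T_top hxv ⟨j, hjk⟩ hj
          · rw [Pi.add_apply, h2 _ h, (tail_at hj hx _).1 rfl]; decide
          · intro i hi
            have hi' : j < i.val := hi
            rw [Pi.add_apply, h2 _ (by omega), (tail_at hj hx i).2.1 hi', zero_add]
        have a := (tail_at hj hx J).2.2 (by omega) (by omega)
        have b := (tail_at hj hy J).2.2 (by omega) (by omega)
        rw [Pi.add_apply, a, zero_add] at b
        exact h1 b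

lemma T_partner {k j : ℕ} (hj : 6 ≤ j) (hjk : j < k) {t t' : Fin k → ZMod 2} (ht : t ∈ tailT k j)
    (ht' : t' ∈ setT k) (h : ∀ i : Fin k, 6 ≤ i.val → (t + t') i = 0) : t' ∈ tailT k j := by
  apply T_top ht' ⟨j, hjk⟩ hj
  · intro h0
    have := h ⟨j, hjk⟩ hj
    rw [Pi.add_apply, h0, (tail_at hj ht _).1 rfl] at this
    exact absurd this (by decide)
  · intro i hi
    have hi' : j < i.val := hi
    have := h i (by omega)
    rwa [Pi.add_apply, (tail_at hj ht _).2.1 hi', zero_add] at this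

lemma T_peel {k i : ℕ} (hi : 6 ≤ i) {t : Fin k → ZMod 2} (ht : t ∈ setT k)
    (ht0 : t + wv k 0 ∈ setT k) (ht1 : t + wv k (i - 1) ∈ setT k)
    (l : Fin k) (hl : i ≤ l.val) (htl : t l ≠ 0) : t = wv k i := by
  rcases ht with ⟨m, hm, rfl⟩ | ⟨j, hj, hjk, ht⟩
  · exact absurd (vb_hi (baseU_lt m hm) l (by omega)) htl
  have hlj : l.val ≤ j := by
    by_contra hc
    exact htl ((tail_at hj ht l).2.1 (by omega))
  have hup : ∀ c, c < j → t + wv k c ∈ setT k → t + wv k c ∈ tailT k j := by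
    intro c hc h
    apply T_top h ⟨j, hjk⟩ hj
    · rw [Pi.add_apply, (tail_at hj ht _).1 rfl]
      simp only [wv]
      rw [if_neg (by omega)]; decide
    · intro i' hi'
      have hi'' : j < i'.val := hi'
      rw [Pi.add_apply, (tail_at hj ht _).2.1 hi'']
      simp only [wv]
      rw [if_neg (by omega), zero_add]
  have h0 := hup 0 (by omega) ht0
  have h1 := hup (i - 1) (by omega) ht1
  have hk0 : 0 < k := by omega
  have hne : ∀ c, c < k → wv k c ≠ 0 := by
    intro c hc h
    have := congrFun h ⟨c, hc⟩
    simp [wv] at this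
  have hne0 : ∀ c d, c ≠ 0 → c < k → wv k c + wv k 0 ≠ wv k d := by
    intro c d hc hck h
    have e0 := congrFun h ⟨0, hk0⟩
    have e1 := congrFun h ⟨c, hck⟩
    simp only [wv, Pi.add_apply] at e0 e1
    rw [if_neg (by omega), if_pos trivial] at e0
    rw [if_pos trivial, if_neg hc] at e1
    by_cases hd : 0 = d
    · subst hd
      rw [if_neg hc] at e1; revert e1; decide
    · rw [if_neg hd] at e0; revert e0; decide
  simp only [tailT, Finset.mem_insert, Finset.mem_singleton] at ht h0 h1
  rcases ht with rfl | rfl | rfl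
  · simp only [add_right_inj, add_eq_left] at h1
    rcases h1 with h1 | h1 | h1
    · exact absurd h1 (hne _ (by omega))
    · have := congrFun h1 ⟨0, hk0⟩
      simp only [wv] at this
      rw [if_neg (by omega), if_pos trivial] at this
      exact absurd this (by decide)
    · have := congrFun h1 ⟨i - 1, by omega⟩
      simp only [wv] at this
      rw [if_pos trivial] at this
      by_cases hc : i - 1 = j - 1
      · rw [show i = j by omega]
      · rw [if_neg hc] at this
        exact absurd this (by decide)
  · exfalso
    simp only [add_assoc, add_right_inj, add_eq_left] at h1
    rw [add_comm (wv k 0)] at h1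
    rcases h1 with h1 | h1 | h1
    · apply hne0 (i - 1) k (by omega) (by omega)
      rw [h1]
      ext x; simp [wv, x.isLt.ne]
    · first
      | exact hne _ (by omega) h1
      | exact hne0 _ _ (by omega) (by omega) h1
    · first
      | exact hne _ (by omega) h1
      | exact hne0 _ _ (by omega) (by omega) h1
  · exfalso
    simp only [add_assoc, add_right_inj, add_eq_left] at h0
    rcases h0 with h1 | h1 | h1
    · apply hne0 (j - 1) k (by omega) (by omega)
      rw [h1]
      ext x; simp [wv, x.isLt.ne]
    · first
      | exact hne _ (by omega) h1
      | exact hne0 _ _ (by omega) (by omega) h1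
    · first
      | exact hne _ (by omega) h1
      | exact hne0 _ _ (by omega) (by omega) h1

/-- An embedding of `C₄ × C₂^k` into `G`. -/
structure Emb (G : Type*) [Group G] (k : ℕ) where
  E : ZMod 4 → (Fin k → ZMod 2) → G
  hE : ∀ c v c' v', E c v * E c' v' = E (c + c') (v + v')
  hinj : ∀ c v c' v', E c v = E c' v' → c = c' ∧ v = v'

/-- The base part of the connection set. -/
def BU {k : ℕ} (e : Emb G k) : Set G := {x | ∃ m ∈ baseU, x = e.E 1 (vb k m)}

/-- The part of the connection set inside the abelian subgroup. -/
def XT {k : ℕ} (e : Emb G k) : Set G := {x | ∃ t ∈ setT k, x = e.E 1 t}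

lemma v_add_self {k : ℕ} (v : Fin k → ZMod 2) : v + v = 0 := by
  ext i
  exact CharTwo.add_self_eq_zero _

lemma Emb.zero {k : ℕ} (e : Emb G k) : e.E 0 0 = 1 := by
  have := e.hE 0 0 0 0
  rw [add_zero, add_zero] at this
  exact mul_eq_left.1 this

lemma BU_sub {k : ℕ} (e : Emb G k) : BU e ⊆ XT e := by
  rintro x ⟨m, hm, rfl⟩
  exact ⟨_, Or.inl ⟨m, hm, rfl⟩, rfl⟩

lemma comN_mono [Finite G] {S B : Set G} (h : B ⊆ S) (s t : G) : comN B s t ≤ comN S s t :=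
  Set.ncard_le_ncard (fun _ hw => ⟨h hw.1, h hw.2⟩) (Set.toFinite _)

lemma nbC_mono [Finite G] {S B : Set G} (h : B ⊆ S) (τ : ℕ) (s : G) : nbC B τ s ≤ nbC S τ s :=
  Set.ncard_le_ncard (fun _ hw => ⟨h hw.1, hw.2.1, hw.2.2.trans (comN_mono h _ _)⟩) (Set.toFinite _)

lemma comN_base {k : ℕ} (hk : 6 ≤ k) (e : Emb G k) {m m' : ℕ} (hm : m ∈ baseU) (hm' : m' ∈ baseU) :
    comN (BU e) (e.E 1 (vb k m)) (e.E 1 (vb k m')) = rhoU (m ^^^ m') := by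
  have hlt : ∀ a ∈ baseU, ∀ b ∈ baseU, a ^^^ b < 64 := fun a ha b hb =>
    Nat.xor_lt_two_pow (n := 6) (baseU_lt a ha) (baseU_lt b hb)
  unfold comN rhoU
  rw [← Set.ncard_coe_finset]
  have : {w | w * (e.E 1 (vb k m))⁻¹ ∈ BU e ∧ w * (e.E 1 (vb k m'))⁻¹ ∈ BU e} =
      (fun x => e.E (1 + 1) (vb k x + vb k m)) ''
        (baseU.filter (fun x => x ^^^ (m ^^^ m') ∈ baseU) : Finset ℕ) := by
    ext w
    constructor
    · rintro ⟨⟨x, hx, h1⟩, ⟨y, hy, h2⟩⟩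
      rw [mul_inv_eq_iff_eq_mul, e.hE] at h1 h2
      refine ⟨x, ?_, h1.symm⟩
      have h3 := (e.hinj _ _ _ _ (h1.symm.trans h2)).2
      rw [vb_add, vb_add] at h3
      have h4 := vb_inj hk (hlt _ hx _ hm) (hlt _ hy _ hm') h3
      have h5 : x ^^^ (m ^^^ m') = y := by
        rw [← Nat.xor_assoc, h4, Nat.xor_assoc, Nat.xor_self, Nat.xor_zero]
      rw [Finset.mem_coe, Finset.mem_filter, h5]
      exact ⟨hx, hy⟩
    · rintro ⟨x, hx, rfl⟩
      rw [Finset.mem_coe, Finset.mem_filter] at hx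
      refine ⟨⟨x, hx.1, ?_⟩, ⟨_, hx.2, ?_⟩⟩
      · rw [mul_inv_eq_iff_eq_mul, e.hE]
      · rw [mul_inv_eq_iff_eq_mul, e.hE]
        show e.E (1 + 1) (vb k x + vb k m) = _
        rw [vb_add, vb_add]
        congr 2
        rw [Nat.xor_assoc, Nat.xor_assoc, Nat.xor_self, Nat.xor_zero]
  rw [this]
  apply Set.InjOn.ncard_image
  intro x hx y hy h
  rw [Finset.mem_coe, Finset.mem_filter] at hx hy
  have h3 := (e.hinj _ _ _ _ h).2
  exact vb_inj hk (baseU_lt _ hx.1) (baseU_lt _ hy.1) (add_right_cancel h3)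

lemma nbC_base {k : ℕ} (hk : 6 ≤ k) (e : Emb G k) (τ : ℕ) {m : ℕ} (hm : m ∈ baseU) :
    nbC (BU e) τ (e.E 1 (vb k m)) = degU τ m := by
  unfold nbC degU
  rw [← Set.ncard_coe_finset]
  have : {t | t ∈ BU e ∧ t ≠ e.E 1 (vb k m) ∧ τ ≤ comN (BU e) (e.E 1 (vb k m)) t} =
      (fun x => e.E 1 (vb k x)) ''
        (baseU.filter (fun b => b ≠ m ∧ τ ≤ rhoU (m ^^^ b)) : Finset ℕ) := by
    ext w
    constructor
    · rintro ⟨⟨x, hx, rfl⟩, h1, h2⟩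
      rw [comN_base hk e hm hx] at h2
      refine ⟨x, ?_, rfl⟩
      rw [Finset.mem_coe, Finset.mem_filter]
      refine ⟨hx, ?_, h2⟩
      rintro rfl
      exact h1 rfl
    · rintro ⟨x, hx, rfl⟩
      rw [Finset.mem_coe, Finset.mem_filter] at hx
      refine ⟨⟨x, hx.1, rfl⟩, ?_, ?_⟩
      · intro h
        exact hx.2.1 (vb_inj hk (baseU_lt _ hx.1) (baseU_lt _ hm) (e.hinj _ _ _ _ h).2)
      · rw [comN_base hk e hm hx.1]; exact hx.2.2
  rw [this]
  apply Set.InjOn.ncard_image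
  intro x hx y hy h
  rw [Finset.mem_coe, Finset.mem_filter] at hx hy
  exact vb_inj hk (baseU_lt _ hx.1) (baseU_lt _ hy.1) (e.hinj _ _ _ _ h).2

lemma tailT_card (k j : ℕ) : (tailT k j).card ≤ 3 := Finset.card_le_three

lemma comN_tail [Finite G] {k : ℕ} (e : Emb G k) {A : Subgroup G} [hAn : A.Normal]
    (hA : ∀ c v, e.E c v ∈ A) {S : Set G}
    {q r : G} (hS : ∀ x, x ∈ S ↔ x ∈ XT e ∨ x = q ∨ x = r) (hq : q ∉ A) (hr : r ∉ A)
    (hqr : q * r⁻¹ ∉ A) {t t' : Fin k → ZMod 2}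
    (i : Fin k) (hi : 6 ≤ i.val) (hv : (t + t') i ≠ 0) :
    comN S (e.E 1 t) (e.E 1 t') ≤ 9 := by
  classical
  -- the top coordinate
  obtain ⟨J, hJ, hmax⟩ : ∃ J : Fin k, (t + t') J ≠ 0 ∧ ∀ l : Fin k, J.val < l.val → (t + t') l = 0 := by
    have hne : (Finset.univ.filter (fun l : Fin k => (t + t') l ≠ 0)).Nonempty :=
      ⟨i, by simpa using hv⟩
    refine ⟨Finset.max' _ hne, ?_, ?_⟩
    · have := Finset.max'_mem _ hne
      exact (Finset.mem_filter.1 this).2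
    · intro l hl
      by_contra hc
      have hmem : l ∈ Finset.univ.filter (fun l : Fin k => (t + t') l ≠ 0) := by simpa using hc
      have := Finset.le_max' _ l hmem
      exact absurd hl (not_lt.2 this)
  have hJ6 : 6 ≤ J.val := by
    by_contra hc
    exact hv (hmax i (by omega))
  have hXA : ∀ x ∈ XT e, x ∈ A := by
    rintro x ⟨t, _, rfl⟩; exact hA _ _
  have htt : e.E 1 t ≠ e.E 1 t' := by
    intro h
    have := (e.hinj _ _ _ _ h).2
    rw [this, v_add_self] at hv
    exact hv rfl
  let C : Finset (Fin k → ZMod 2) :=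
    tailT k J.val ∪ (tailT k J.val).image (fun x => x + (t + t')) ∪ tailT k (J.val + 1)
  have hC : C.card ≤ 9 := by
    have a1 := Finset.card_union_le
      (tailT k J.val ∪ (tailT k J.val).image (fun x => x + (t + t'))) (tailT k (J.val + 1))
    have a2 := Finset.card_union_le
      (tailT k J.val) ((tailT k J.val).image (fun x => x + (t + t')))
    have a3 := Finset.card_image_le (s := tailT k J.val) (f := fun x => x + (t + t'))
    have a4 := tailT_card k J.val
    have a5 := tailT_card k (J.val + 1)
    show (tailT k J.val ∪ (tailT k J.val).image (fun x => x + (t + t')) ∪ tailT k (J.val + 1)).card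
      ≤ 9
    omega
  have hsub : {w | w * (e.E 1 t)⁻¹ ∈ S ∧ w * (e.E 1 t')⁻¹ ∈ S} ⊆
      (fun x => e.E 1 x * e.E 1 t) '' (C : Set (Fin k → ZMod 2)) := by
    rintro w ⟨h1, h2⟩
    obtain ⟨u, rfl⟩ : ∃ u, w = u * e.E 1 t := ⟨w * (e.E 1 t)⁻¹, by group⟩
    rw [mul_inv_cancel_right] at h1
    have hd : e.E 1 t * (e.E 1 t')⁻¹ ∈ A := A.mul_mem (hA _ _) (A.inv_mem (hA _ _))
    rw [mul_assoc] at h2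
    have hd1 : e.E 1 t * (e.E 1 t')⁻¹ ≠ 1 := fun h => htt (mul_inv_eq_one.1 h)
    rw [hS] at h1 h2
    rcases h1 with h1 | h1
    · obtain ⟨x, hx, rfl⟩ := h1
      refine ⟨x, ?_, rfl⟩
      rcases h2 with h2 | h2
      · obtain ⟨y, hy, h3⟩ := h2
        rw [← mul_assoc, mul_inv_eq_iff_eq_mul, e.hE, e.hE] at h3
        have h4 := (e.hinj _ _ _ _ h3).2
        have h5 : x + (t + t') = y := by
          rw [← add_assoc, h4, add_assoc, v_add_self, add_zero]
        rw [← h5] at hy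
        have := T_cover J hJ6 hJ hmax hx hy
        simp only [C, Finset.coe_union, Finset.coe_image, Set.mem_union, Finset.mem_coe]
        rcases this with h | h | h
        · exact Or.inl (Or.inl h)
        · left; right
          refine ⟨_, h, ?_⟩
          show x + (t + t') + (t + t') = x
          rw [add_assoc, v_add_self, add_zero]
        · exact Or.inr h
      · exfalso
        have := A.mul_mem (hA 1 x) hd
        rcases h2 with h2 | h2 <;> rw [h2] at this
        · exact hq this
        · exact hr this
    · exfalso
      generalize e.E 1 t * (e.E 1 t')⁻¹ = d at hd hd1 h2
      rcases h1 with rfl | rfl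
      · rcases h2 with h2 | h2 | h2
        · exact hq ((A.mul_mem_cancel_right hd).1 (hXA _ h2))
        · exact hd1 (mul_eq_left.1 h2)
        · apply hqr
          rw [← h2]
          have := hAn.conj_mem _ (A.inv_mem hd) u
          rwa [show u * (u * d)⁻¹ = u * d⁻¹ * u⁻¹ by group]
      · rcases h2 with h2 | h2 | h2
        · exact hr ((A.mul_mem_cancel_right hd).1 (hXA _ h2))
        · apply hqr
          rw [← h2]
          exact hAn.conj_mem _ hd u
        · exact hd1 (mul_eq_left.1 h2)
  calc comN S (e.E 1 t) (e.E 1 t') ≤ _ := Set.ncard_le_ncard hsub (Set.toFinite _)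
    _ ≤ _ := Set.ncard_image_le (Set.toFinite _)
    _ = C.card := Set.ncard_coe_finset C
    _ ≤ 9 := hC

/-- The configuration of an abelian subgroup with two outer elements. -/
structure Cfg {k : ℕ} (e : Emb G k) (A : Subgroup G) (q r : G) : Prop where
  hA : ∀ x, x ∈ A ↔ ∃ c v, x = e.E c v
  hq : q ∉ A
  hr : r ∉ A
  hqq : q * q ∈ A
  hrr : r * r ∈ A
  hqr : q * r⁻¹ ∉ A

/-- The connection set. -/
def SS {k : ℕ} (e : Emb G k) (q r : G) : Set G := {x | x ∈ XT e ∨ x = q ∨ x = r}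

lemma Cfg.mem {k : ℕ} {e : Emb G k} {A : Subgroup G} {q r : G} (h : Cfg e A q r) (c v) :
    e.E c v ∈ A := (h.hA _).2 ⟨c, v, rfl⟩

lemma Cfg.symm {k : ℕ} {e : Emb G k} {A : Subgroup G} {q r : G} (h : Cfg e A q r) :
    Cfg e A r q where
  hA := h.hA
  hq := h.hr
  hr := h.hq
  hqq := h.hrr
  hrr := h.hqq
  hqr := fun h' => h.hqr (by simpa using A.inv_mem h')

lemma Cfg.XA {k : ℕ} {e : Emb G k} {A : Subgroup G} {q r : G} (h : Cfg e A q r) :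
    ∀ x ∈ XT e, x ∈ A := by
  rintro x ⟨t, _, rfl⟩; exact h.mem _ _

lemma nbC_q [Finite G] {k : ℕ} {e : Emb G k} {A : Subgroup G} [A.Normal] {q r : G}
    (h : Cfg e A q r) {S : Set G} (hS : ∀ x, x ∈ S ↔ x ∈ XT e ∨ x = q ∨ x = r) :
    nbC S 10 q = 0 := by
  unfold nbC
  rw [Set.ncard_eq_zero]
  ext t
  simp only [Set.mem_ofPred_eq, Set.mem_empty_iff_false, iff_false]
  rintro ⟨h1, h2, h3⟩
  have := comN_q_le h.XA hS h.hq h.hr h.hqq h.hrr h.hqr h1 h2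
  omega

lemma nbC_tail [Finite G] {k : ℕ} {e : Emb G k} {A : Subgroup G} [A.Normal] {q r : G}
    (h : Cfg e A q r) {S : Set G} (hS : ∀ x, x ∈ S ↔ x ∈ XT e ∨ x = q ∨ x = r)
    {j : ℕ} (hj : 6 ≤ j) (hjk : j < k) {t : Fin k → ZMod 2} (ht : t ∈ tailT k j) :
    nbC S 10 (e.E 1 t) ≤ 2 := by
  classical
  have hS' : ∀ x, x ∈ S ↔ x ∈ XT e ∨ x = r ∨ x = q := fun x => by rw [hS]; tauto
  have htS : e.E 1 t ∈ S := (hS _).2 (Or.inl ⟨t, Or.inr ⟨j, hj, hjk, ht⟩, rfl⟩)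
  have hcomm : ∀ a b : G, comN S a b = comN S b a := by
    intro a b
    unfold comN
    congr 1
    ext w
    exact and_comm
  have hsub : {t' | t' ∈ S ∧ t' ≠ e.E 1 t ∧ 10 ≤ comN S (e.E 1 t) t'} ⊆
      (fun x => e.E 1 x) '' ((tailT k j).erase t : Finset (Fin k → ZMod 2)) := by
    rintro x ⟨h1, h2, h3⟩
    rcases (hS x).1 h1 with ⟨t', ht', rfl⟩ | rfl | rfl
    · refine ⟨t', ?_, rfl⟩
      rw [Finset.mem_coe, Finset.mem_erase]
      refine ⟨fun hh => h2 (by rw [hh]), ?_⟩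
      apply T_partner hj hjk ht ht'
      intro i hi
      by_contra hc
      have := comN_tail e h.mem hS h.hq h.hr h.hqr i hi hc
      omega
    · rw [hcomm] at h3
      have := comN_q_le h.XA hS h.hq h.hr h.hqq h.hrr h.hqr htS h2.symm
      omega
    · rw [hcomm] at h3
      have h' := h.symm
      have := comN_q_le h'.XA hS' h'.hq h'.hr h'.hqq h'.hrr h'.hqr htS h2.symm
      omega
  calc nbC S 10 (e.E 1 t) ≤ _ := Set.ncard_le_ncard hsub (Set.toFinite _)
    _ ≤ _ := Set.ncard_image_le (Set.toFinite _)
    _ = ((tailT k j).erase t).card := Set.ncard_coe_finset _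
    _ ≤ 2 := by
      have := Finset.card_erase_of_mem ht
      have := tailT_card k j
      omega

lemma BU_char [Finite G] {k : ℕ} (hk : 6 ≤ k) {e : Emb G k} {A : Subgroup G} [A.Normal] {q r : G}
    (h : Cfg e A q r) (s : G) : s ∈ BU e ↔ s ∈ SS e q r ∧ 3 ≤ nbC (SS e q r) 10 s := by
  have hS : ∀ x, x ∈ SS e q r ↔ x ∈ XT e ∨ x = q ∨ x = r := fun x => Iff.rfl
  have hS' : ∀ x, x ∈ SS e q r ↔ x ∈ XT e ∨ x = r ∨ x = q := fun x => by rw [hS]; tauto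
  have hsub : BU e ⊆ SS e q r := fun x hx => Or.inl (BU_sub e hx)
  constructor
  · intro hs
    refine ⟨hsub hs, ?_⟩
    obtain ⟨m, hm, rfl⟩ := hs
    refine le_trans ?_ (nbC_mono hsub 10 _)
    rw [nbC_base hk e 10 hm]
    exact baseU_deg m hm
  · rintro ⟨h1, h2⟩
    rcases h1 with ⟨t, ht, rfl⟩ | rfl | rfl
    · rcases ht with ⟨m, hm, rfl⟩ | ⟨j, hj, hjk, ht⟩
      · exact ⟨m, hm, rfl⟩
      · have := nbC_tail h hS hj hjk ht
        omega
    · rw [nbC_q h hS] at h2; omega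
    · rw [nbC_q h.symm hS'] at h2; omega

lemma autF_base [Finite G] {k : ℕ} (hk : 6 ≤ k) {e : Emb G k} {A : Subgroup G} [A.Normal] {q r : G}
    (h : Cfg e A q r) {m : ℕ} (hm : m ∈ ({0, 1, 2, 4, 8, 16, 32} : Finset ℕ)) :
    e.E 1 (vb k m) ∈ autF (SS e q r) := by
  have hmU : m ∈ baseU := by
    revert m; decide +kernel
  apply mem_autF
  intro φ hφ h1
  have hB := sub_aut (BU_char hk h) hφ
  have hmem : φ (e.E 1 (vb k m)) ∈ BU e := (aut_mem hB h1 _).1 ⟨m, hmU, rfl⟩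
  obtain ⟨b, hb, hbe⟩ := hmem
  have h8 := nbC_aut hB h1 8 (e.E 1 (vb k m))
  have h6 := nbC_aut hB h1 6 (e.E 1 (vb k m))
  rw [hbe, nbC_base hk e _ hb, nbC_base hk e _ hmU] at h8 h6
  rw [hbe, baseU_sep m hm b hb h8 h6]

lemma vb_zero (k : ℕ) : vb k 0 = 0 := by
  ext i; simp [vb]

lemma vb_pow (k i : ℕ) : vb k (2 ^ i) = wv k i := by
  ext l
  simp only [vb, wv, Nat.testBit_two_pow]
  by_cases h : i = l.val
  · simp [h]
  · have : ¬ l.val = i := fun h' => h h'.symm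
    simp [h, this]

/-- If the subgroup contains `E 1 0` and `E 0 w_j` for `j<i`, it contains all elements
supported below `i`. -/
lemma supp_mem {k : ℕ} (e : Emb G k) (F : Subgroup G) (h0 : e.E 1 0 ∈ F) (i : ℕ)
    (hw : ∀ j, j < i → e.E 0 (wv k j) ∈ F) (c : ZMod 4) (v : Fin k → ZMod 2)
    (hv : ∀ l : Fin k, i ≤ l.val → v l = 0) : e.E c v ∈ F := by
  have hc : ∀ n : ℕ, e.E (n : ZMod 4) 0 ∈ F := by
    intro n
    induction n with
    | zero => rw [Nat.cast_zero, e.zero]; exact F.one_mem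
    | succ n ih =>
      have := F.mul_mem ih h0
      rwa [e.hE, add_zero, ← Nat.cast_succ] at this
  have hc' : e.E c 0 ∈ F := by
    have := hc c.val
    rwa [ZMod.natCast_zmod_val] at this
  have hv' : ∀ i, (∀ j, j < i → e.E 0 (wv k j) ∈ F) → ∀ v : Fin k → ZMod 2,
      (∀ l : Fin k, i ≤ l.val → v l = 0) → e.E 0 v ∈ F := by
    intro i
    induction i with
    | zero =>
      intro _ v hv
      have : v = 0 := funext fun l => hv l (Nat.zero_le _)
      rw [this, e.zero]; exact F.one_mem
    | succ i ih =>
      intro hw v hv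
      by_cases hex : ∃ l : Fin k, l.val = i ∧ v l ≠ 0
      · obtain ⟨l, hl, hvl⟩ := hex
        have h1 : v l = 1 := by
          generalize v l = x at hvl
          revert x; decide
        have h2 := ih (fun j hj => hw j (by omega)) (v + wv k i) (by
          intro l' hl'
          by_cases h : l'.val = i
          · have : l' = l := Fin.ext (h.trans hl.symm)
            rw [this, Pi.add_apply, h1]
            simp only [wv, hl, if_true]
            decide
          · simp [wv, h, hv l' (by omega)])
        have := F.mul_mem h2 (hw i (by omega))
        rwa [e.hE, add_zero, add_assoc, v_add_self, add_zero] at this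
      · push Not at hex
        apply ih (fun j hj => hw j (by omega))
        intro l hl
        by_cases h : l.val = i
        · exact hex l h
        · exact hv l (by omega)
  have := F.mul_mem hc' (hv' i hw v hv)
  rwa [e.hE, add_zero, zero_add] at this

lemma autF_w [Finite G] {k : ℕ} (hk : 6 ≤ k) {e : Emb G k} {A : Subgroup G} [hAn : A.Normal]
    {q r : G} (h : Cfg e A q r) :
    e.E 1 0 ∈ autF (SS e q r) ∧ ∀ i, i < k → e.E 0 (wv k i) ∈ autF (SS e q r) := by
  set F := autF (SS e q r) with hF
  have h0 : e.E 1 0 ∈ F := by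
    have := autF_base hk h (m := 0) (by decide)
    rwa [vb_zero] at this
  have h0' : ∀ v, e.E 1 v ∈ F → e.E 0 v ∈ F := by
    intro v hv
    have := F.mul_mem (F.inv_mem h0) hv
    have h2 : (e.E 1 0)⁻¹ * e.E 1 v = e.E 0 v := by
      rw [inv_mul_eq_iff_eq_mul, e.hE, add_zero, zero_add]
    rwa [h2] at this
  refine ⟨h0, ?_⟩
  intro i
  induction i using Nat.strong_induction_on with
  | _ i ih =>
  intro hik
  by_cases hi : i < 6
  · apply h0'
    rw [← vb_pow]
    apply autF_base hk h
    interval_cases i <;> decide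
  · push Not at hi
    apply h0'
    apply mem_autF
    intro φ hφ h1
    have hw : ∀ j, j < i → e.E 0 (wv k j) ∈ F := fun j hj => ih j hj (by omega)
    have tl : ∀ x ∈ tailT k i, e.E 1 x ∈ SS e q r :=
      fun x hx => Or.inl ⟨x, Or.inr ⟨i, hi, hik, hx⟩, rfl⟩
    have m0 := (aut_mem hφ h1 _).1 (tl (wv k i) (by simp [tailT]))
    have step : ∀ j, j < i → wv k i + wv k j ∈ tailT k i →
        e.E 0 (wv k j) * φ (e.E 1 (wv k i)) ∈ SS e q r := by
      intro j hj hx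
      have := (aut_mem hφ h1 _).1 (tl _ hx)
      have e1 : e.E 1 (wv k i + wv k j) = e.E 0 (wv k j) * e.E 1 (wv k i) := by
        rw [e.hE, zero_add, add_comm]
      rwa [e1, hw j hj φ hφ] at this
    have m1 := step 0 (by omega) (by simp [tailT])
    have m2 := step (i - 1) (by omega) (by simp [tailT])
    have hw0 : e.E 0 (wv k 0) ≠ 1 := by
      rw [← e.zero]
      intro hh
      have := congrFun (e.hinj _ _ _ _ hh).2 ⟨0, by omega⟩
      simp [wv] at this
    generalize hs : φ (e.E 1 (wv k i)) = s at m0 m1 m2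
    have notq : ∀ q r : G, Cfg e A q r → e.E 0 (wv k 0) * q ∈ XT e ∨
        e.E 0 (wv k 0) * q = q ∨ e.E 0 (wv k 0) * q = r → False := by
      rintro q r h (hh | hh | hh)
      · exact h.hq ((A.mul_mem_cancel_left (h.mem _ _)).1 (h.XA _ hh))
      · exact hw0 (mul_eq_right.1 hh)
      · apply h.symm.hqr
        rw [← hh, mul_inv_cancel_right]
        exact h.mem _ _
    rcases m0 with ⟨t, ht, rfl⟩ | rfl | rfl
    · have inX : ∀ j, e.E 0 (wv k j) * e.E 1 t ∈ SS e q r → t + wv k j ∈ setT k := by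
        rintro j (⟨x, hx, hh⟩ | hh | hh)
        · rw [e.hE] at hh
          rw [add_comm, (e.hinj _ _ _ _ hh).2]; exact hx
        · exact absurd (hh ▸ A.mul_mem (h.mem _ _) (h.mem _ _)) h.hq
        · exact absurd (hh ▸ A.mul_mem (h.mem _ _) (h.mem _ _)) h.hr
      by_cases hsup : ∃ l : Fin k, i ≤ l.val ∧ t l ≠ 0
      · obtain ⟨l, hl, htl⟩ := hsup
        rw [T_peel hi ht (inX 0 m1) (inX (i - 1) m2) l hl htl]
      · push Not at hsup
        have hm := supp_mem e F h0 i hw 1 t hsup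
        have := autF_fix hm hφ h1
        exact (φ.injective (hs.trans this.symm)) ▸ rfl
    · exact absurd m1 (fun hh => notq _ _ h hh)
    · exact absurd m1 (fun hh => notq _ _ h.symm (by
        rcases hh with hh | hh | hh
        · exact Or.inl hh
        · exact Or.inr (Or.inr hh)
        · exact Or.inr (Or.inl hh)))

theorem main_orr [Finite G] {k : ℕ} (hk : 6 ≤ k) {e : Emb G k} {A : Subgroup G} [hAn : A.Normal]
    {q r : G} (h : Cfg e A q r) (hq2 : q * q ≠ 1) (hr2 : r * r ≠ 1) (a0 : G) (ha0 : a0 ∈ A)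
    (hconj : q * a0 * q⁻¹ ≠ r * a0 * r⁻¹)
    (hgen : ∀ F : Subgroup G, A ≤ F → q ∈ F → r ∈ F → F = ⊤) : HasORR G := by
  refine ⟨SS e q r, ?_, ?_⟩
  · ext x
    simp only [Set.mem_inter_iff, Set.mem_inv, Set.mem_empty_iff_false, iff_false]
    rintro ⟨h1, h2⟩
    have key : ∀ q r : G, Cfg e A q r → q * q ≠ 1 → q⁻¹ ∈ XT e ∨ q⁻¹ = q ∨ q⁻¹ = r → False := by
      rintro q r h hq2 (hh | hh | hh)
      · exact h.hq (A.inv_mem_iff.1 (h.XA _ hh))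
      · exact hq2 (inv_eq_iff_mul_eq_one.1 hh)
      · apply h.hqr
        rw [← hh, inv_inv]
        exact h.hqq
    rcases h1 with ⟨t, ht, rfl⟩ | rfl | rfl
    · rcases h2 with ⟨t', ht', hh⟩ | hh | hh
      · rw [inv_eq_iff_mul_eq_one, e.hE, ← e.zero] at hh
        have := (e.hinj _ _ _ _ hh).1
        revert this; decide
      · exact h.hq (hh ▸ A.inv_mem (h.mem _ _))
      · exact h.hr (hh ▸ A.inv_mem (h.mem _ _))
    · exact key _ _ h hq2 h2
    · exact key _ _ h.symm hr2 (by
        rcases h2 with hh | hh | hh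
        · exact Or.inl hh
        · exact Or.inr (Or.inr hh)
        · exact Or.inr (Or.inl hh))
  · obtain ⟨h0, hw⟩ := autF_w hk h
    have hAF : A ≤ autF (SS e q r) := by
      intro x hx
      obtain ⟨c, v, rfl⟩ := (h.hA x).1 hx
      exact supp_mem e _ h0 k hw c v (fun l hl => absurd l.2 (by omega))
    have notA : ∀ φ : Equiv.Perm G, IsCayleyAut (SS e q r) φ → φ 1 = 1 → ∀ x, x ∉ A → φ x ∉ A := by
      intro φ hφ h1 x hx hx'
      have := autF_fix (hAF hx') hφ h1
      rw [φ.injective this] at hx'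
      exact hx hx'
    have hqF : q ∈ autF (SS e q r) := by
      apply mem_autF
      intro φ hφ h1
      have hm := (aut_mem hφ h1 q).1 (Or.inr (Or.inl rfl))
      rcases hm with hm | hm | hm
      · exact absurd (h.XA _ hm) (notA φ hφ h1 q h.hq)
      · exact hm
      · exfalso
        have hqa : q * a0 * q⁻¹ ∈ A := hAn.conj_mem _ ha0 q
        have h2 := (hφ a0 (q * a0)).1 (by rw [mul_inv_cancel_right]; exact Or.inr (Or.inl rfl))
        have e1 : q * a0 = (q * a0 * q⁻¹) * q := by group
        rw [autF_fix (hAF ha0) hφ h1, e1, hAF hqa φ hφ, hm] at h2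
        have hrr : r * a0⁻¹ * r⁻¹ ∈ A := hAn.conj_mem _ (A.inv_mem ha0) r
        have e2 : (q * a0 * q⁻¹) * r * a0⁻¹ = (q * a0 * q⁻¹) * (r * a0⁻¹ * r⁻¹) * r := by group
        have hd := A.mul_mem hqa hrr
        rw [e2] at h2
        rcases h2 with h2 | h2 | h2
        · exact h.hr ((A.mul_mem_cancel_left hd).1 (h.XA _ h2))
        · apply h.hqr
          rw [← mul_inv_eq_iff_eq_mul.2 h2.symm] at hd
          exact hd
        · apply hconj
          have h3 := mul_eq_right.1 h2
          rw [mul_eq_one_iff_eq_inv] at h3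
          rw [h3]; group
    have hrF : r ∈ autF (SS e q r) := by
      apply mem_autF
      intro φ hφ h1
      have hm := (aut_mem hφ h1 r).1 (Or.inr (Or.inr rfl))
      rcases hm with hm | hm | hm
      · exact absurd (h.XA _ hm) (notA φ hφ h1 r h.hr)
      · have := φ.injective (hm.trans (autF_fix hqF hφ h1).symm)
        exact absurd (by rw [this, mul_inv_cancel]; exact A.one_mem) h.hqr
      · exact hm
    have htop := hgen _ hAF hqF hrF
    intro φ hφ
    refine ⟨φ 1, fun v => ?_⟩
    have hv : v ∈ autF (SS e q r) := by rw [htop]; trivial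
    have := hv φ hφ 1
    rwa [mul_one] at this

lemma gd_of (B0 : Set G) (g : G) (hg2 : g * g = 1)
    (hcomm : ∀ x ∈ B0, ∀ y ∈ B0, x * y = y * x) (hinv : ∀ x ∈ B0, g * x * g = x⁻¹)
    (hgen : Subgroup.closure (B0 ∪ {g}) = ⊤) (p : G) (hp : p ∈ Subgroup.closure B0)
    (hp2 : p * p ≠ 1) : IsGeneralizedDihedral G := by
  have hC : ∀ a ∈ Subgroup.closure B0, ∀ b ∈ Subgroup.closure B0, a * b = b * a := by
    have h1 : Subgroup.closure B0 ≤ Subgroup.centralizer B0 := by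
      rw [Subgroup.closure_le]
      intro x hx
      rw [SetLike.mem_coe, Subgroup.mem_centralizer_iff]
      intro y hy
      exact hcomm y hy x hx
    have h2 : Subgroup.closure B0 ≤
        Subgroup.centralizer (Subgroup.closure B0 : Set G) := by
      rw [Subgroup.closure_le]
      intro x hx
      rw [SetLike.mem_coe, Subgroup.mem_centralizer_iff]
      intro y hy
      exact ((Subgroup.mem_centralizer_iff.1 (h1 hy)) x hx).symm
    intro a ha b hb
    exact Subgroup.mem_centralizer_iff.1 (h2 hb) a ha
  have gi : g⁻¹ = g := inv_eq_of_mul_eq_one_left hg2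
  have hI : ∀ a ∈ Subgroup.closure B0, g * a * g = a⁻¹ := by
    intro a ha
    induction ha using Subgroup.closure_induction with
    | mem x hx => exact hinv x hx
    | one => simpa using hg2
    | mul x y hx hy h1 h2 =>
      rw [hC x hx y hy, mul_inv_rev, ← h1, ← h2, hC y hy x hx]
      calc g * (x * y) * g = g * x * 1 * y * g := by group
        _ = g * x * (g * g) * y * g := by rw [hg2]
        _ = _ := by group
    | inv x hx h1 =>
      rw [inv_inv, ← h1]
      calc g * (g * x * g) * g = (g * g) * x * (g * g) := by group
        _ = _ := by rw [hg2, one_mul, mul_one]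
  refine ⟨Subgroup.closure B0, hC, g, ?_, hg2, hI, ?_⟩
  · intro hg
    apply hp2
    have h1 := hI p hp
    rw [hC g hg p hp, mul_assoc, hg2, mul_one] at h1
    exact mul_eq_one_iff_eq_inv.2 h1
  · intro x
    have hx : x ∈ Subgroup.closure (B0 ∪ {g}) := by rw [hgen]; trivial
    induction hx using Subgroup.closure_induction with
    | mem x hx =>
      rcases hx with hx | hx
      · exact Or.inl (Subgroup.subset_closure hx)
      · exact Or.inr ⟨1, Subgroup.one_mem _, by rw [Set.mem_singleton_iff.1 hx, one_mul]⟩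
    | one => exact Or.inl (Subgroup.one_mem _)
    | mul x y _ _ h1 h2 =>
      rcases h1 with h1 | ⟨a, ha, rfl⟩ <;> rcases h2 with h2 | ⟨b, hb, rfl⟩
      · exact Or.inl (Subgroup.mul_mem _ h1 h2)
      · exact Or.inr ⟨x * b, Subgroup.mul_mem _ h1 hb, by group⟩
      · refine Or.inr ⟨a * y⁻¹, Subgroup.mul_mem _ ha (Subgroup.inv_mem _ h2), ?_⟩
        rw [← hI y h2]
        calc a * g * y = a * g * y * 1 := by group
          _ = a * g * y * (g * g) := by rw [hg2]
          _ = _ := by group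
      · refine Or.inl ?_
        have : a * g * (b * g) = a * b⁻¹ := by rw [← hI b hb]; group
        rw [this]
        exact Subgroup.mul_mem _ ha (Subgroup.inv_mem _ hb)
    | inv x _ h1 =>
      rcases h1 with h1 | ⟨a, ha, rfl⟩
      · exact Or.inl (Subgroup.inv_mem _ h1)
      · refine Or.inr ⟨a, ha, ?_⟩
        rw [mul_inv_rev, ← hI a ha, gi]
        calc g * (g * a * g) = (g * g) * a * g := by group
          _ = _ := by rw [hg2, one_mul]

theorem final_aux [Finite G] (k : ℕ) (A : Subgroup G) (e : Emb G k)
    (hA : ∀ x, x ∈ A ↔ ∃ c v, x = e.E c v)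
    (hAcomm : ∀ y ∈ A, ∀ z ∈ A, y * z = z * y)
    (g n : G)
    (hgen : Subgroup.closure ((A : Set G) ∪ {g, n}) = ⊤)
    (hg2 : g * g = 1)
    (hginv : ∀ y ∈ A, g⁻¹ * y * g = y⁻¹)
    (hng : g⁻¹ * n * g = n⁻¹)
    (hnnorm : ∀ y ∈ A, n⁻¹ * y * n ∈ A)
    (hn2 : n * n ∈ A)
    (hk : 6 ≤ k) :
    IsGeneralizedDihedral G ∨ HasORR G := by
  have gi : g⁻¹ = g := inv_eq_of_mul_eq_one_left hg2
  rw [gi] at hng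
  simp only [gi] at hginv
  have hn' : ∀ y ∈ A, n * y * n⁻¹ ∈ A := by
    intro y hy
    have := A.mul_mem (A.mul_mem hn2 (hnnorm y hy)) (A.inv_mem hn2)
    have e1 : n * n * (n⁻¹ * y * n) * (n * n)⁻¹ = n * y * n⁻¹ := by group
    rwa [e1] at this
  have ha0 : e.E 1 0 ∈ A := (hA _).2 ⟨_, _, rfl⟩
  have ha02 : e.E 1 0 * e.E 1 0 ≠ 1 := by
    rw [e.hE, ← e.zero]
    intro h
    have := (e.hinj _ _ _ _ h).1
    revert this; decide
  generalize e.E 1 0 = a0 at ha0 ha02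
  have gen' : ∀ F : Subgroup G, (∀ a ∈ A, a ∈ F) → g ∈ F → n ∈ F → F = ⊤ := by
    intro F h1 h2 h3
    rw [eq_top_iff, ← hgen, Subgroup.closure_le]
    rintro x (hx | rfl | rfl)
    · exact h1 x hx
    · exact h2
    · exact h3
  by_cases h1 : ∀ a ∈ A, n * a = a * n
  · left
    apply gd_of ((A : Set G) ∪ {n}) g hg2 _ _ _ a0 (Subgroup.subset_closure (Or.inl ha0)) ha02
    · rintro x (hx | rfl) y (hy | rfl)
      · exact hAcomm x hx y hy
      · exact (h1 x hx).symm
      · exact h1 y hy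
      · rfl
    · rintro x (hx | rfl)
      · exact hginv x hx
      · exact hng
    · apply gen'
      · exact fun a ha => Subgroup.subset_closure (Or.inl (Or.inl ha))
      · exact Subgroup.subset_closure (Or.inr rfl)
      · exact Subgroup.subset_closure (Or.inl (Or.inr rfl))
  by_cases h2 : ∀ y ∈ A, (y * n) * (y * n) = 1
  · left
    have hnn : n * n = 1 := by simpa using h2 1 A.one_mem
    have ni : n⁻¹ = n := inv_eq_of_mul_eq_one_left hnn
    have hgn : g * n = n * g := by
      rw [ni] at hng
      calc g * n = g * n * (g * g) := by rw [hg2, mul_one]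
        _ = (g * n * g) * g := by group
        _ = n * g := by rw [hng]
    have hc : ∀ a ∈ A, (g * n) * a = a * (g * n) := by
      intro a ha
      have h3 : n * a * n = a⁻¹ := by
        have := h2 a ha
        rw [eq_inv_iff_mul_eq_one, mul_eq_one_comm]
        rw [← this]; group
      calc g * n * a = g * (n * a * n) * n⁻¹ := by group
        _ = g * a⁻¹ * n := by rw [h3, ni]
        _ = g * (g * a * g) * n := by rw [hginv a ha]
        _ = (g * g) * a * (g * n) := by group
        _ = _ := by rw [hg2, one_mul]
    apply gd_of ((A : Set G) ∪ {g * n}) g hg2 _ _ _ a0 (Subgroup.subset_closure (Or.inl ha0)) ha02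
    · rintro x (hx | rfl) y (hy | rfl)
      · exact hAcomm x hx y hy
      · exact (hc x hx).symm
      · exact hc y hy
      · rfl
    · rintro x (hx | rfl)
      · exact hginv x hx
      · rw [mul_inv_rev, ni, gi, ← mul_assoc, hg2, one_mul]
    · have hgc : g ∈ Subgroup.closure ((A : Set G) ∪ {g * n} ∪ {g}) :=
        Subgroup.subset_closure (Or.inr rfl)
      apply gen'
      · exact fun a ha => Subgroup.subset_closure (Or.inl (Or.inl ha))
      · exact hgc
      · have := Subgroup.mul_mem _ hgc (Subgroup.subset_closure
          (show g * n ∈ (A : Set G) ∪ {g * n} ∪ {g} from Or.inl (Or.inr rfl)))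
        rwa [← mul_assoc, hg2, one_mul] at this
  right
  push Not at h1 h2
  obtain ⟨z, hz, hnz⟩ := h1
  obtain ⟨y, hy, hyn⟩ := h2
  have hgA : g ∉ A := by
    intro hg
    have h3 := hginv a0 ha0
    rw [hAcomm g hg a0 ha0, mul_assoc, hg2, mul_one] at h3
    exact ha02 (mul_eq_one_iff_eq_inv.2 h3)
  have hnA : n ∉ A := fun hn => hnz (hAcomm n hn z hz)
  have hgnA : g * n ∉ A := by
    intro h
    apply hyn
    have h3 := hginv _ (A.mul_mem h hy)
    calc y * n * (y * n) = y * (g * g) * n * y * (g * g) * n := by rw [hg2]; group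
      _ = y * (g * (g * n * y) * g) * (g * n) := by group
      _ = 1 := by rw [h3]; group
  have hAn : A.Normal := by
    rw [← Subgroup.normalizer_eq_top_iff]
    apply gen'
    · exact fun a ha => Subgroup.le_normalizer ha
    · rw [Subgroup.mem_normalizer_iff]
      intro h
      rw [gi]
      constructor
      · intro hh; rw [hginv h hh]; exact A.inv_mem hh
      · intro hh
        have h3 := hginv _ hh
        have h4 : g * (g * h * g) * g = h := by
          calc g * (g * h * g) * g = (g * g) * h * (g * g) := by group
            _ = h := by rw [hg2, one_mul, mul_one]
        rw [h4] at h3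
        rw [h3]; exact A.inv_mem hh
    · rw [Subgroup.mem_normalizer_iff]
      intro h
      refine ⟨hn' h, fun hh => ?_⟩
      have := hnnorm _ hh
      rwa [show n⁻¹ * (n * h * n⁻¹) * n = h by group] at this
  have hgngn : g * n * (g * n) = 1 := by
    calc g * n * (g * n) = (g * n * g) * n := by group
      _ = 1 := by rw [hng]; group
  have hrsq : z * (g * n) * (z * (g * n)) = z * (n * z * n⁻¹)⁻¹ := by
    rw [← hginv _ (hn' z hz)]
    calc z * (g * n) * (z * (g * n)) = z * (g * (n * z * n⁻¹) * (n * g * n)) := by group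
      _ = z * (g * (n * z * n⁻¹) * ((g * g) * (n * g * n))) := by rw [hg2]; group
      _ = z * (g * (n * z * n⁻¹) * (g * (g * n * (g * n)))) := by group
      _ = _ := by rw [hgngn, mul_one]
  have cfg : Cfg e A (y * n) (z * (g * n)) :=
    { hA := hA
      hq := fun h => hnA ((A.mul_mem_cancel_left hy).1 h)
      hr := fun h => hgnA ((A.mul_mem_cancel_left hz).1 h)
      hqq := by
        have := A.mul_mem (A.mul_mem hy (hn' y hy)) hn2
        rwa [show y * (n * y * n⁻¹) * (n * n) = y * n * (y * n) by group] at this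
      hrr := by
        rw [hrsq]
        exact A.mul_mem hz (A.inv_mem (hn' z hz))
      hqr := by
        rw [show y * n * (z * (g * n))⁻¹ = y * g⁻¹ * z⁻¹ by group, gi]
        intro h
        exact hgA ((A.mul_mem_cancel_left hy).1 ((A.mul_mem_cancel_right (A.inv_mem hz)).1 h)) }
  refine main_orr hk cfg hyn ?_ a0 ha0 ?_ ?_
  · rw [hrsq]
    intro h
    apply hnz
    have h3 := mul_inv_eq_one.1 h
    nth_rewrite 2 [h3]
    group
  · have hb := hn' a0 ha0
    have e1 : y * n * a0 * (y * n)⁻¹ = n * a0 * n⁻¹ := by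
      calc y * n * a0 * (y * n)⁻¹ = y * (n * a0 * n⁻¹) * y⁻¹ := by group
        _ = _ := by rw [hAcomm y hy _ hb, mul_inv_cancel_right]
    have e2 : z * (g * n) * a0 * (z * (g * n))⁻¹ = (n * a0 * n⁻¹)⁻¹ := by
      calc z * (g * n) * a0 * (z * (g * n))⁻¹ = z * (g * (n * a0 * n⁻¹) * g⁻¹) * z⁻¹ := by group
        _ = _ := by
          rw [gi, hginv _ hb, hAcomm z hz _ (A.inv_mem hb), mul_inv_cancel_right]
    rw [e1, e2]
    intro h
    apply ha02
    have h3 := mul_eq_one_iff_eq_inv.2 h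
    calc a0 * a0 = n⁻¹ * (n * a0 * n⁻¹ * (n * a0 * n⁻¹)) * n := by group
      _ = 1 := by rw [h3]; group
  · intro F hF hqF hrF
    have hnF : n ∈ F := (F.mul_mem_cancel_left (hF hy)).1 hqF
    have hgF : g ∈ F :=
      (F.mul_mem_cancel_right hnF).1 ((F.mul_mem_cancel_left (hF hz)).1 hrF)
    exact gen' F hF hgF hnF

theorem exists_emb (k : ℕ) (A : Subgroup G)
    (f : A ≃* Multiplicative (ZMod 4 × (Fin k → ZMod 2))) :
    ∃ e : Emb G k, ∀ x, x ∈ A ↔ ∃ c v, x = e.E c v := by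
  refine ⟨⟨fun c v => (f.symm (Multiplicative.ofAdd (c, v)) : G), ?_, ?_⟩, ?_⟩
  · intro c v c' v'
    rw [← Subgroup.coe_mul, ← map_mul, ← ofAdd_add, Prod.mk_add_mk]
  · intro c v c' v' h
    have h1 := f.symm.injective (Subtype.ext h)
    exact Prod.mk.inj (Multiplicative.ofAdd.injective h1)
  · intro x
    constructor
    · intro hx
      refine ⟨(Multiplicative.toAdd (f ⟨x, hx⟩)).1, (Multiplicative.toAdd (f ⟨x, hx⟩)).2, ?_⟩
      simp
    · rintro ⟨c, v, rfl⟩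
      exact Subtype.property _

end ORRProof

/-- Let `G = ⟨A, g, n⟩` be a 2-group where `A ≅ C₄ × C₂^k` is abelian with generators
`a 0, …, a k` (`a 0` of order 4, the rest of order 2), `g² = 1`, conjugation by `g`
inverts `A`, `nᵍ = n⁻¹`, `n` normalises `A` and `n² ∈ A`. If `k ≥ 6`, then either
`G` is generalised dihedral or `G` admits an oriented regular representation. -/
theorem gen_dihedral_or_hasORR {G : Type*} [Group G] [Finite G]
    (k : ℕ) (hG : IsPGroup 2 G)
    (A : Subgroup G)
    (hAiso : Nonempty (A ≃* Multiplicative (ZMod 4 × (Fin k → ZMod 2))))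
    (hAcomm : ∀ y ∈ A, ∀ z ∈ A, y * z = z * y)
    (a : Fin (k + 1) → G)
    (hagen : Subgroup.closure (Set.range a) = A)
    (ha0 : orderOf (a 0) = 4)
    (hai : ∀ i : Fin (k + 1), i ≠ 0 → orderOf (a i) = 2)
    (g n : G)
    (hgen : Subgroup.closure ((A : Set G) ∪ {g, n}) = ⊤)
    (hg2 : g * g = 1)
    (hginv : ∀ y ∈ A, g⁻¹ * y * g = y⁻¹)
    (hng : g⁻¹ * n * g = n⁻¹)
    (hnnorm : ∀ y ∈ A, n⁻¹ * y * n ∈ A)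
    (hn2 : n * n ∈ A)
    (hk : 6 ≤ k) :
    IsGeneralizedDihedral G ∨ HasORR G := by
  obtain ⟨f⟩ := hAiso
  obtain ⟨e, he⟩ := exists_emb k A f
  exact final_aux k A e he hAcomm g n hgen hg2 hginv hng hnnorm hn2 hk
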